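/- For all real numbers a, b, every real number c ≥ 0, and every natural number k ≥ 1, the integral of (a − b·e^{−cξ})·ξ^{k/2}/(1+e^{ξ}) over ξ from 0 to ∞ equals Γ(1+k/2)·[a·(1−2^{−k/2})·ζ(1+k/2) − b·(2^{−k/2}·ζ(1+k/2, (c+1)/2) − ζ(1+k/2, c+1))], where ζ(s) is the Riemann zeta function and ζ(s, q) the Hurwitz zeta function. -/

import Mathlib

/-- The Hurwitz zeta function for real s > 1 and q > 0, defined by its series
ζ(s, q) = Σ_{n=0}^∞ (n+q)^{−s}. -/
noncomputable def hurwitzZetaReal (s q : ℝ) : ℝ := ∑' n : ℕ, 1 / ((n : ℝ) + q) ^ s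

lemma hz_summable {s q : ℝ} (hs : 1 < s) (hq : 0 < q) :
    Summable (fun n : ℕ => 1 / ((n : ℝ) + q) ^ s) := by
  refine ((Real.summable_one_div_nat_add_rpow q s).2 hs).congr fun n => ?_
  rw [abs_of_pos (by positivity)]

lemma hz_even {s q : ℝ} (hs : 1 < s) (hq : 0 < q) :
    HasSum (fun m : ℕ => 1 / (((2 * m : ℕ) : ℝ) + q) ^ s)
      ((2 : ℝ) ^ (-s) * hurwitzZetaReal s (q / 2)) := by
  have h := (hz_summable hs (half_pos hq)).hasSum.mul_left ((2 : ℝ) ^ (-s))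
  refine h.congr_fun fun m => ?_
  have : (((2 * m : ℕ) : ℝ) + q) = 2 * ((m : ℝ) + q / 2) := by push_cast; ring
  rw [this, Real.mul_rpow (by norm_num) (by positivity), Real.rpow_neg (by norm_num)]
  field_simp

lemma hz_odd {s q : ℝ} (hs : 1 < s) (hq : 0 < q) :
    HasSum (fun m : ℕ => 1 / (((2 * m + 1 : ℕ) : ℝ) + q) ^ s)
      ((2 : ℝ) ^ (-s) * hurwitzZetaReal s ((q + 1) / 2)) := by
  refine (hz_even hs (show 0 < q + 1 by linarith)).congr_fun fun m => ?_
  push_cast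
  ring_nf

lemma hz_dup {s q : ℝ} (hs : 1 < s) (hq : 0 < q) :
    hurwitzZetaReal s q = (2 : ℝ) ^ (-s) * hurwitzZetaReal s (q / 2)
      + (2 : ℝ) ^ (-s) * hurwitzZetaReal s ((q + 1) / 2) :=
  ((hz_even hs hq).even_add_odd (f := fun n : ℕ => 1 / ((n : ℝ) + q) ^ s) (hz_odd hs hq)).tsum_eq

lemma hz_alt {s q : ℝ} (hs : 1 < s) (hq : 0 < q) :
    HasSum (fun n : ℕ => (-1 : ℝ) ^ n * (1 / ((n : ℝ) + q) ^ s))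
      ((2 : ℝ) ^ (1 - s) * hurwitzZetaReal s (q / 2) - hurwitzZetaReal s q) := by
  have h := HasSum.even_add_odd (f := fun n : ℕ => (-1 : ℝ) ^ n * (1 / ((n : ℝ) + q) ^ s))
    ((hz_even hs hq).congr_fun fun m => by simp)
    ((hz_odd hs hq).neg.congr_fun fun m => by simp [pow_succ])
  convert h using 1
  rw [hz_dup hs hq, sub_eq_add_neg 1 s, Real.rpow_add (by norm_num), Real.rpow_one]
  ring

lemma hz_one {s : ℝ} (hs : 1 < s) :
    (hurwitzZetaReal s 1 : ℂ) = riemannZeta (s : ℂ) := by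
  rw [zeta_eq_tsum_one_div_nat_add_one_cpow (by simpa using hs), hurwitzZetaReal, Complex.ofReal_tsum]
  refine tsum_congr fun n => ?_
  rw [Complex.ofReal_div, Complex.ofReal_cpow (by positivity)]
  push_cast
  rfl

lemma hz_half {s : ℝ} (hs : 1 < s) :
    (2 : ℝ) ^ (1 - s) * hurwitzZetaReal s (1 / 2) - hurwitzZetaReal s 1
      = (1 - (2 : ℝ) ^ (1 - s)) * hurwitzZetaReal s 1 := by
  have h := hz_dup hs one_pos
  rw [show ((1 : ℝ) + 1) / 2 = 1 by norm_num] at h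
  rw [sub_eq_add_neg 1 s, Real.rpow_add (by norm_num), Real.rpow_one]
  linear_combination (-2) * h

open MeasureTheory in
lemma fd_int {s r : ℝ} (hs : 1 < s) (hr : 0 < r) :
    IntegrableOn (fun t : ℝ => t ^ (s - 1) * Real.exp (-(r * t))) (Set.Ioi 0) := by
  have := integrableOn_rpow_mul_exp_neg_mul_rpow (s := s - 1) (p := 1) (b := r)
    (by linarith) one_pos hr
  simpa using this

open MeasureTheory in
lemma fd_model {s c : ℝ} (hs : 1 < s) (hc : 0 ≤ c) :
    IntegrableOn (fun t : ℝ => Real.exp (-c * t) * t ^ (s - 1) / (1 + Real.exp t)) (Set.Ioi 0) ∧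
    ∫ t in Set.Ioi (0 : ℝ), Real.exp (-c * t) * t ^ (s - 1) / (1 + Real.exp t) =
      Real.Gamma s * ((2 : ℝ) ^ (1 - s) * hurwitzZetaReal s ((c + 1) / 2)
        - hurwitzZetaReal s (c + 1)) := by
  have hq : 0 < c + 1 := by linarith
  have hn : ∀ n : ℕ, 0 < (n : ℝ) + (c + 1) := fun n => by positivity
  constructor
  · refine (fd_int hs one_pos).mono' ?_ ?_
    · exact Measurable.aestronglyMeasurable (by fun_prop)
    · refine (ae_restrict_iff' measurableSet_Ioi).2 (Filter.Eventually.of_forall fun t ht => ?_)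
      have ht' : (0 : ℝ) < t := ht
      have hp : 0 < t ^ (s - 1) := Real.rpow_pos_of_pos ht' _
      rw [Real.norm_of_nonneg (by positivity), one_mul, Real.exp_neg, div_le_iff₀ (by positivity)]
      have h1 : Real.exp (-c * t) ≤ 1 := Real.exp_le_one_iff.2 (by nlinarith)
      have h2 := Real.exp_pos t
      have h3 : (1 : ℝ) ≤ (Real.exp t)⁻¹ * (1 + Real.exp t) := by
        rw [mul_add, inv_mul_cancel₀ h2.ne']; have := inv_pos.2 h2; linarith
      nlinarith [mul_le_mul_of_nonneg_left h3 hp.le, mul_le_mul_of_nonneg_left h1 hp.le]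
  · let F : ℕ → ℝ → ℝ := fun n t => (-1 : ℝ) ^ n * (t ^ (s - 1) * Real.exp (-(((n : ℝ) + (c + 1)) * t)))
    have hval : ∀ n : ℕ, ∫ t in Set.Ioi (0 : ℝ), t ^ (s - 1) * Real.exp (-(((n : ℝ) + (c + 1)) * t))
        = Real.Gamma s * (1 / ((n : ℝ) + (c + 1)) ^ s) := fun n => by
      rw [Real.integral_rpow_mul_exp_neg_mul_Ioi (by linarith) (hn n),
        Real.div_rpow zero_le_one (hn n).le, Real.one_rpow, mul_comm]
    have hF : ∀ n, Integrable (F n) (volume.restrict (Set.Ioi 0)) := fun n =>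
      (fd_int hs (hn n)).const_mul _
    have hnorm : ∀ n, ∫ t in Set.Ioi (0 : ℝ), ‖F n t‖ = Real.Gamma s * (1 / ((n : ℝ) + (c + 1)) ^ s) := by
      intro n
      rw [← hval n]
      refine setIntegral_congr_fun measurableSet_Ioi fun t ht => ?_
      have hp : 0 < t ^ (s - 1) := Real.rpow_pos_of_pos ht _
      simp only [F, norm_mul, norm_pow, norm_neg, norm_one, one_pow, one_mul]
      rw [Real.norm_of_nonneg hp.le, Real.norm_of_nonneg (Real.exp_pos _).le]
    have hsum : Summable fun n => ∫ t in Set.Ioi (0 : ℝ), ‖F n t‖ := by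
      simp_rw [hnorm]
      exact (hz_summable hs hq).mul_left _
    have H := hasSum_integral_of_summable_integral_norm hF hsum
    have H2 : HasSum (fun n => ∫ t in Set.Ioi (0 : ℝ), F n t) (Real.Gamma s *
        ((2 : ℝ) ^ (1 - s) * hurwitzZetaReal s ((c + 1) / 2) - hurwitzZetaReal s (c + 1))) := by
      refine ((hz_alt hs hq).mul_left (Real.Gamma s)).congr_fun fun n => ?_
      simp only [F]
      rw [integral_const_mul, hval]
      ring
    rw [← H.unique H2]
    refine setIntegral_congr_fun measurableSet_Ioi fun t ht => ?_
    have ht' : (0 : ℝ) < t := ht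
    have hlt : Real.exp (-t) < 1 := by rw [← Real.exp_zero]; exact Real.exp_lt_exp.2 (by linarith)
    have hg := (hasSum_geometric_of_abs_lt_one (r := -Real.exp (-t))
      (by rwa [abs_neg, abs_of_pos (Real.exp_pos _)])).mul_left
        (t ^ (s - 1) * Real.exp (-((c + 1) * t)))
    have hg2 : HasSum (fun n => F n t) (t ^ (s - 1) * Real.exp (-((c + 1) * t)) *
        (1 - -Real.exp (-t))⁻¹) := by
      refine hg.congr_fun fun n => ?_
      simp only [F]
      rw [neg_pow (Real.exp (-t)), ← Real.exp_nat_mul,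
        show -(((n : ℝ) + (c + 1)) * t) = -((c + 1) * t) + n * -t by ring, Real.exp_add]
      ring
    rw [hg2.tsum_eq]
    rw [show -((c + 1) * t) = -c * t + -t by ring, Real.exp_add, Real.exp_neg t]
    have he := Real.exp_pos t
    have hinv : (1 - -(Real.exp t)⁻¹)⁻¹ = Real.exp t / (1 + Real.exp t) := by
      rw [sub_neg_eq_add, inv_eq_one_div, div_eq_div_iff (by positivity) (by positivity)]
      field_simp
      ring
    rw [hinv]
    field_simp


/-- for real a, b, real c ≥ 0 and natural k ≥ 1,
∫_0^∞ (a − b·e^{−cξ})·ξ^{k/2}/(1+e^ξ) dξ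
  = Γ(1+k/2)·[a·(1−2^{−k/2})·ζ(1+k/2) − b·(2^{−k/2}·ζ(1+k/2,(c+1)/2) − ζ(1+k/2,c+1))]. -/
theorem fermiDirac_general_model (a b c : ℝ) (hc : 0 ≤ c) (k : ℕ) (hk : 1 ≤ k) :
    ((∫ ξ in Set.Ioi (0 : ℝ),
        (a - b * Real.exp (-c * ξ)) * ξ ^ ((k : ℝ) / 2) / (1 + Real.exp ξ) : ℝ) : ℂ) =
      (Real.Gamma (1 + (k : ℝ) / 2) : ℂ) *
        ((a : ℂ) * (1 - ((2 : ℝ) ^ (-(k : ℝ) / 2) : ℝ)) * riemannZeta (1 + (k : ℂ) / 2) -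
          (b : ℂ) * (((2 : ℝ) ^ (-(k : ℝ) / 2) : ℝ) *
              (hurwitzZetaReal (1 + (k : ℝ) / 2) ((c + 1) / 2) : ℂ) -
            (hurwitzZetaReal (1 + (k : ℝ) / 2) (c + 1) : ℂ))) := by
  have hs : (1 : ℝ) < 1 + (k : ℝ) / 2 := by
    have : (1 : ℝ) ≤ k := by exact_mod_cast hk
    linarith
  obtain ⟨i0, e0⟩ := fd_model hs le_rfl
  obtain ⟨ic, ec⟩ := fd_model hs hc
  rw [zero_add, hz_half hs] at e0
  simp only [add_sub_cancel_left] at i0 e0 ic ec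
  have hE : (1 : ℝ) - (1 + (k : ℝ) / 2) = -(k : ℝ) / 2 := by ring
  rw [hE] at e0 ec
  have key : ∫ ξ in Set.Ioi (0 : ℝ),
        (a - b * Real.exp (-c * ξ)) * ξ ^ ((k : ℝ) / 2) / (1 + Real.exp ξ) =
      a * (∫ t in Set.Ioi (0 : ℝ), Real.exp (-0 * t) * t ^ ((k : ℝ) / 2) / (1 + Real.exp t))
      - b * ∫ t in Set.Ioi (0 : ℝ), Real.exp (-c * t) * t ^ ((k : ℝ) / 2) / (1 + Real.exp t) := by
    rw [← MeasureTheory.integral_const_mul, ← MeasureTheory.integral_const_mul,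
      ← MeasureTheory.integral_sub (i0.const_mul a) (ic.const_mul b)]
    congr 1
    ext t
    simp only [neg_zero, zero_mul, Real.exp_zero]
    ring
  have hz := hz_one hs
  have hcast : ((1 + (k : ℝ) / 2 : ℝ) : ℂ) = 1 + (k : ℂ) / 2 := by push_cast; rfl
  rw [hcast] at hz
  rw [key, e0, ec, ← hz]
  push_cast
  ring
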